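/- Let S ≥ 3, let 0 = x_1 < ⋯ < x_S = 1 with values y_1, …, y_S satisfying |y_i − y_j| ≤ L·|x_i − x_j| for all i, j with L ≥ 0, let λ ≥ L, let y⁺ = max_s y_s, and define μ and σ piecewise on [0,1] by μ(x) = (y_{s−1}·(x_s − x) + y_s·(x − x_{s−1}))/(x_s − x_{s−1}) and σ(x) = λ·√((x_s − x)·(x − x_{s−1})/(x_s − x_{s−1})) for x ∈ [x_{s−1}, x_s]. Define the expected improvement acquisition function with ξ = 0: q(x) = (μ(x) − y⁺)·Φ((μ(x) − y⁺)/σ(x)) + σ(x)·φ((μ(x) − y⁺)/σ(x)) if σ(x) > 0 and q(x) = 0 if σ(x) = 0. Then every x ∈ [0, 1] with ū(x) > y⁺, where ū(x) = min_s(y_s + L·|x − x_s|), satisfies q(x) > 0; i.e., the upper bound region is contained in the search region of the expected improvement function. -/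

import Mathlib

/-- The standard normal probability density function. -/
noncomputable def stdNormalPDF (z : ℝ) : ℝ :=
  (Real.sqrt (2 * Real.pi))⁻¹ * Real.exp (-(z ^ 2) / 2)

/-- The standard normal cumulative distribution function. -/
noncomputable def stdNormalCDF (z : ℝ) : ℝ := ∫ t in Set.Iic z, stdNormalPDF t

open MeasureTheory Filter Topology

theorem stdNormalPDF_pos (z : ℝ) : 0 < stdNormalPDF z := by
  unfold stdNormalPDF
  positivity

theorem integrable_stdNormalPDF : Integrable stdNormalPDF := by
  have h := (integrable_exp_neg_mul_sq (b := 1 / 2) (by norm_num)).const_mul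
    (Real.sqrt (2 * Real.pi))⁻¹
  refine h.congr (Eventually.of_forall fun t => ?_)
  simp only [stdNormalPDF]
  ring_nf

theorem integrable_mul_stdNormalPDF : Integrable fun t => t * stdNormalPDF t := by
  have h := (integrable_mul_exp_neg_mul_sq (b := 1 / 2) (by norm_num)).const_mul
    (Real.sqrt (2 * Real.pi))⁻¹
  refine h.congr (Eventually.of_forall fun t => ?_)
  simp only [stdNormalPDF]
  ring_nf

theorem hasDerivAt_stdNormalPDF (t : ℝ) :
    HasDerivAt stdNormalPDF (-(t * stdNormalPDF t)) t := by
  have h := ((((hasDerivAt_id t).pow 2).neg.div_const 2).exp).const_mul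
    (Real.sqrt (2 * Real.pi))⁻¹
  refine h.congr_deriv ?_
  simp [stdNormalPDF]
  ring

theorem tendsto_stdNormalPDF_atBot : Tendsto stdNormalPDF atBot (𝓝 0) := by
  have hsq : Tendsto (fun t : ℝ => t ^ 2 / 2) atBot atTop :=
    Tendsto.atTop_div_const two_pos <| by
      simpa [Function.comp_def] using (tendsto_pow_atTop (α := ℝ) two_ne_zero).comp
        tendsto_abs_atBot_atTop
  have h := (Real.tendsto_exp_neg_atTop_nhds_zero.comp hsq).const_mul
    (Real.sqrt (2 * Real.pi))⁻¹
  rw [mul_zero] at h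
  refine h.congr fun t => ?_
  simp [stdNormalPDF, neg_div]

theorem setIntegral_Iic_neg_mul_stdNormalPDF (z : ℝ) :
    ∫ t in Set.Iic z, -(t * stdNormalPDF t) = stdNormalPDF z := by
  rw [integral_Iic_of_hasDerivAt_of_tendsto' (fun t _ => hasDerivAt_stdNormalPDF t)
    integrable_mul_stdNormalPDF.neg.integrableOn tendsto_stdNormalPDF_atBot, sub_zero]

/-- The normalized expected improvement `z Φ(z) + φ(z)` is the integral of `(z - t) φ(t)` over
`t ≤ z`. -/
theorem mul_stdNormalCDF_add_stdNormalPDF_eq (z : ℝ) :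
    z * stdNormalCDF z + stdNormalPDF z = ∫ t in Set.Iic z, (z - t) * stdNormalPDF t := by
  rw [← setIntegral_Iic_neg_mul_stdNormalPDF, stdNormalCDF, ← integral_const_mul,
    integral_neg, ← sub_eq_add_neg, ← integral_sub
      (integrable_stdNormalPDF.const_mul z).integrableOn integrable_mul_stdNormalPDF.integrableOn]
  congr 1 with t
  ring

theorem mul_stdNormalCDF_add_stdNormalPDF_pos (z : ℝ) :
    0 < z * stdNormalCDF z + stdNormalPDF z := by
  rw [mul_stdNormalCDF_add_stdNormalPDF_eq, setIntegral_pos_iff_support_of_nonneg_ae]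
  · have hsub : Set.Iio z ⊆ Function.support (fun t => (z - t) * stdNormalPDF t) ∩ Set.Iic z :=
      fun t ht => ⟨(mul_pos (sub_pos.2 ht) (stdNormalPDF_pos t)).ne', (Set.mem_Iio.1 ht).le⟩
    refine lt_of_lt_of_le ?_ (measure_mono hsub)
    simp
  · filter_upwards [ae_restrict_mem measurableSet_Iic] with t ht
    exact mul_nonneg (sub_nonneg.2 ht) (stdNormalPDF_pos t).le
  · refine ((integrable_stdNormalPDF.const_mul z).sub
      integrable_mul_stdNormalPDF).integrableOn.congr_fun (fun t _ => ?_) measurableSet_Iic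
    simp only [Pi.sub_apply]
    ring

theorem expectedImprovement_pos (w : ℝ) {s : ℝ} (hs : 0 < s) :
    0 < w * stdNormalCDF (w / s) + s * stdNormalPDF (w / s) := by
  have h := mul_pos hs (mul_stdNormalCDF_add_stdNormalPDF_pos (w / s))
  rwa [mul_add, ← mul_assoc, mul_div_cancel₀ w hs.ne'] at h

/-- with observation points `0 = x_1 < ⋯ < x_S = 1` (0-indexed:
`xs 0 = 0`, `xs (S−1) = 1`), Lipschitz-consistent values, kernel scale `λ ≥ L`, and the
expected improvement acquisition function `q` with `ξ = 0` built from the piecewise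
Dirichlet-kernel posterior mean `μ` and standard deviation `σ`, every `x ∈ [0, 1]` in
the upper bound region (`ū(x) > y⁺`) satisfies `q(x) > 0`. -/
theorem upper_bound_region_in_expected_improvement_search_region
    (S : ℕ) (hS : 3 ≤ S) (L lam : ℝ) (hL : 0 ≤ L) (hlam : L ≤ lam)
    (xs ys : ℕ → ℝ) (hx0 : xs 0 = 0) (hx1 : xs (S - 1) = 1)
    (hmono : ∀ i j, i < j → j < S → xs i < xs j)
    (hlip : ∀ i < S, ∀ j < S, |ys i - ys j| ≤ L * |xs i - xs j|)
    (μ σ : ℝ → ℝ)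
    (hμσ : ∀ s, 1 ≤ s → s < S → ∀ x ∈ Set.Icc (xs (s - 1)) (xs s),
      μ x = (ys (s - 1) * (xs s - x) + ys s * (x - xs (s - 1))) / (xs s - xs (s - 1)) ∧
      σ x = lam * Real.sqrt ((xs s - x) * (x - xs (s - 1)) / (xs s - xs (s - 1)))) :
    ∀ x ∈ Set.Icc (0 : ℝ) 1,
      (Finset.range S).sup' (Finset.nonempty_range_iff.mpr (by omega)) (fun s => ys s)
          < (Finset.range S).inf' (Finset.nonempty_range_iff.mpr (by omega))
              (fun s => ys s + L * |x - xs s|) →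
      0 < (if 0 < σ x then
            (μ x - (Finset.range S).sup' (Finset.nonempty_range_iff.mpr (by omega))
                (fun s => ys s))
              * stdNormalCDF ((μ x - (Finset.range S).sup'
                  (Finset.nonempty_range_iff.mpr (by omega)) (fun s => ys s)) / σ x)
            + σ x * stdNormalPDF ((μ x - (Finset.range S).sup'
                  (Finset.nonempty_range_iff.mpr (by omega)) (fun s => ys s)) / σ x)
          else 0) := by
  intro x hx hU
  have hkey : ∀ s < S, 0 < L * |x - xs s| := by
    intro s hs
    have h₁ := Finset.le_sup' (fun s => ys s) (Finset.mem_range.2 hs)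
    have h₂ := Finset.inf'_le (fun s => ys s + L * |x - xs s|) (Finset.mem_range.2 hs)
    linarith
  have hne : ∀ s < S, x ≠ xs s := by
    intro s hs h
    simpa [h] using hkey s hs
  have hLpos : 0 < L := by
    refine hL.lt_of_ne fun h => ?_
    simpa [← h] using hkey 0 (by omega)
  have hex : ∃ s, x ≤ xs s := ⟨S - 1, hx1 ▸ hx.2⟩
  classical
  obtain ⟨s, hs, hmin⟩ : ∃ s, x ≤ xs s ∧ ∀ m < s, ¬ x ≤ xs m :=
    ⟨Nat.find hex, Nat.find_spec hex, fun m => Nat.find_min hex⟩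
  have hsS : s < S := by
    by_contra h
    exact hmin (S - 1) (by omega) (hx1 ▸ hx.2)
  have hs1 : 1 ≤ s := by
    rw [Nat.one_le_iff_ne_zero]
    rintro rfl
    exact hne 0 hsS (le_antisymm hs (hx0 ▸ hx.1))
  have hleft : xs (s - 1) < x := not_le.1 (hmin (s - 1) (by omega))
  have hright : x < xs s := hs.lt_of_ne (hne s hsS)
  have hσ : 0 < σ x := by
    rw [(hμσ s hs1 hsS x ⟨hleft.le, hs⟩).2]
    exact mul_pos (hLpos.trans_le hlam) (Real.sqrt_pos.2
      (div_pos (mul_pos (sub_pos.2 hright) (sub_pos.2 hleft)) (sub_pos.2 (hleft.trans hright))))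
  rw [if_pos hσ]
  exact expectedImprovement_pos _ hσ
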